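/- For 0<q<p≤1, n∈ℕ with n≥1, and x≥0, the central moments of the King-type (p,q)-Baskakov operator satisfy B*_{n,p,q}(t−x;x) = r_n(x) − x and B*_{n,p,q}((t−x)²;x) = 2x² − 2x·r_n(x). -/

import Mathlib

open Real Set Filter

/-- The (p,q)-integer [n]_{p,q} = (p^n - q^n)/(p - q). -/
noncomputable def pqInt (p q : ℝ) (n : ℕ) : ℝ := (p ^ n - q ^ n) / (p - q)

/-- The (p,q)-factorial [n]_{p,q}! . -/
noncomputable def pqFact (p q : ℝ) : ℕ → ℝ
  | 0 => 1
  | n + 1 => pqInt p q (n + 1) * pqFact p q n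

/-- The (p,q)-binomial coefficient. -/
noncomputable def pqChoose (p q : ℝ) (n k : ℕ) : ℝ :=
  pqFact p q n / (pqFact p q k * pqFact p q (n - k))

/-- (1 ⊕ x)^n_{p,q} = ∏_{j=0}^{n-1} (p^j + q^j x). -/
noncomputable def pqOnePlusPow (p q x : ℝ) (n : ℕ) : ℝ :=
  ∏ j ∈ Finset.range n, (p ^ j + q ^ j * x)

/-- The (p,q)-Baskakov operator B_{n,p,q}(f;x). -/
noncomputable def baskakov (p q : ℝ) (n : ℕ) (f : ℝ → ℝ) (x : ℝ) : ℝ :=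
  ∑' k : ℕ, pqChoose p q (n + k - 1) k * p ^ (k + n * (n - 1) / 2) *
    q ^ (k * (k - 1) / 2) * (x ^ k / pqOnePlusPow p q x (n + k)) *
    f (p ^ (n - 1) * pqInt p q k / (q ^ (k - 1) * pqInt p q n))

/-- The function r_n(x) used in the King-type modification. -/
noncomputable def rn (p q : ℝ) (n : ℕ) (x : ℝ) : ℝ :=
  (-(p ^ (n - 1)) +
      Real.sqrt (p ^ (2 * n - 2) + 4 * pqInt p q n * (pqInt p q n + p ^ n / q) * x ^ 2)) /
    (2 * (pqInt p q n + p ^ n / q))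

/-- The King-type (p,q)-Baskakov operator B*_{n,p,q}(f;x) = B_{n,p,q}(f; r_n(x)). -/
noncomputable def kingBaskakov (p q : ℝ) (n : ℕ) (f : ℝ → ℝ) (x : ℝ) : ℝ :=
  baskakov p q n f (rn p q n x)

theorem pqInt_zero (p q : ℝ) : pqInt p q 0 = 0 := by simp [pqInt]

theorem pqInt_pos {p q : ℝ} (hq : 0 < q) (hqp : q < p) {n : ℕ} (hn : n ≠ 0) :
    0 < pqInt p q n :=
  div_pos (sub_pos.2 (pow_lt_pow_left₀ hqp hq.le hn)) (sub_pos.2 hqp)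

theorem pqFact_pos {p q : ℝ} (hq : 0 < q) (hqp : q < p) (n : ℕ) : 0 < pqFact p q n := by
  induction n with
  | zero => simp [pqFact]
  | succ n ih => exact mul_pos (pqInt_pos hq hqp n.succ_ne_zero) ih

theorem pqInt_add {p q : ℝ} (hqp : q < p) (a b : ℕ) :
    pqInt p q (a + b) = q ^ b * pqInt p q a + p ^ a * pqInt p q b := by
  have : p - q ≠ 0 := (sub_pos.2 hqp).ne'
  unfold pqInt
  field_simp
  ring

theorem pqInt_one {p q : ℝ} (hqp : q < p) : pqInt p q 1 = 1 := by
  simp [pqInt, (sub_pos.2 hqp).ne']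

theorem pqOnePlusPow_succ (p q x : ℝ) (n : ℕ) :
    pqOnePlusPow p q x (n + 1) = pqOnePlusPow p q x n * (p ^ n + q ^ n * x) :=
  Finset.prod_range_succ _ _

theorem pqFactor_pos {p q x : ℝ} (hq : 0 < q) (hqp : q < p) (hx : 0 ≤ x) (n : ℕ) :
    0 < p ^ n + q ^ n * x :=
  add_pos_of_pos_of_nonneg (pow_pos (hq.trans hqp) n) (mul_nonneg (pow_pos hq n).le hx)

theorem pqOnePlusPow_pos {p q x : ℝ} (hq : 0 < q) (hqp : q < p) (hx : 0 ≤ x) (n : ℕ) :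
    0 < pqOnePlusPow p q x n :=
  Finset.prod_pos fun j _ => pqFactor_pos hq hqp hx j

/-- The weight multiplying the value of the function in the `k`-th term of `baskakov`. -/
noncomputable def baskakovWeight (p q : ℝ) (n : ℕ) (x : ℝ) (k : ℕ) : ℝ :=
  pqChoose p q (n + k - 1) k * p ^ (k + n * (n - 1) / 2) *
    q ^ (k * (k - 1) / 2) * (x ^ k / pqOnePlusPow p q x (n + k))

/-- The node at which the `k`-th term of `baskakov` evaluates the function. -/
noncomputable def baskakovNode (p q : ℝ) (n k : ℕ) : ℝ :=
  p ^ (n - 1) * pqInt p q k / (q ^ (k - 1) * pqInt p q n)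

/-- The probability of `n` failures and `k` successes in `n + k` independent trials, where the
`j`-th trial fails with probability `p ^ j / (p ^ j + q ^ j * x)`. -/
noncomputable def trialWeight (p q x : ℝ) (n k : ℕ) : ℝ :=
  pqFact p q (n + k) / (pqFact p q k * pqFact p q n) * p ^ (n * (n - 1) / 2) *
    q ^ (k * (k - 1) / 2) * (x ^ k / pqOnePlusPow p q x (n + k))

theorem trialWeight_nonneg {p q x : ℝ} (hq : 0 < q) (hqp : q < p) (hx : 0 ≤ x) (n k : ℕ) :
    0 ≤ trialWeight p q x n k := by
  have := hq.trans hqp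
  have := pqOnePlusPow_pos hq hqp hx (n + k)
  have := pqFact_pos hq hqp (n + k)
  have := pqFact_pos hq hqp k
  have := pqFact_pos hq hqp n
  unfold trialWeight
  positivity

theorem baskakovWeight_succ {p q x : ℝ} (n k : ℕ) :
    baskakovWeight p q (n + 1) x k =
      trialWeight p q x n k * (p ^ (n + k) / (p ^ (n + k) + q ^ (n + k) * x)) := by
  have e : n + 1 + k - 1 = n + k := by lia
  rw [baskakovWeight, trialWeight, pqChoose, e, Nat.add_sub_cancel, Nat.triangle_succ,
    show n + 1 + k = n + k + 1 by lia, pqOnePlusPow_succ]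
  generalize p ^ (n + k) + q ^ (n + k) * x = D
  ring

theorem trialWeight_succ_succ {p q x : ℝ} (hq : 0 < q) (hqp : q < p) (hx : 0 ≤ x) (n k : ℕ) :
    trialWeight p q x (n + 1) (k + 1) =
      trialWeight p q x (n + 1) k *
          (q ^ (n + 1 + k) * x / (p ^ (n + 1 + k) + q ^ (n + 1 + k) * x)) +
        baskakovWeight p q (n + 1) x (k + 1) := by
  have := (pqFact_pos hq hqp k).ne'
  have := (pqFact_pos hq hqp n).ne'
  have := (pqInt_pos hq hqp n.succ_ne_zero).ne'
  have := (pqInt_pos hq hqp k.succ_ne_zero).ne'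
  have := (pqFactor_pos hq hqp hx (n + 1 + k)).ne'
  have := (pqOnePlusPow_pos hq hqp hx (n + 1 + k)).ne'
  have h : pqFact p q (n + 1 + k + 1) =
      (q ^ (n + 1) * pqInt p q (k + 1) + p ^ (k + 1) * pqInt p q (n + 1)) *
        pqFact p q (n + 1 + k) := by
    rw [pqFact, show n + 1 + k + 1 = (k + 1) + (n + 1) by lia, pqInt_add hqp]
  rw [baskakovWeight_succ, trialWeight, trialWeight, trialWeight,
    show n + 1 + (k + 1) = n + 1 + k + 1 by lia, show n + (k + 1) = n + 1 + k by lia,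
    pqOnePlusPow_succ, h, Nat.triangle_succ, Nat.triangle_succ]
  simp only [pqFact]
  field_simp
  ring

theorem trialWeight_succ_zero {p q x : ℝ} (hq : 0 < q) (hqp : q < p) (n : ℕ) :
    trialWeight p q x (n + 1) 0 = baskakovWeight p q (n + 1) x 0 := by
  have := (pqFact_pos hq hqp n).ne'
  have := (pqInt_pos hq hqp n.succ_ne_zero).ne'
  simp only [trialWeight, baskakovWeight, pqChoose, pqFact, add_zero, Nat.add_sub_cancel,
    Nat.sub_zero, zero_add]
  field_simp

theorem trialWeight_zero_succ {p q x : ℝ} (hq : 0 < q) (hqp : q < p) (hx : 0 ≤ x) (k : ℕ) :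
    trialWeight p q x 0 (k + 1) =
      trialWeight p q x 0 k * (q ^ k * x / (p ^ k + q ^ k * x)) := by
  have := (pqFact_pos hq hqp k).ne'
  have := (pqInt_pos hq hqp k.succ_ne_zero).ne'
  have := (pqFactor_pos hq hqp hx k).ne'
  have := (pqOnePlusPow_pos hq hqp hx k).ne'
  rw [trialWeight, trialWeight, Nat.triangle_succ]
  simp only [zero_add]
  simp only [pqOnePlusPow_succ, pqFact]
  field_simp
  ring

theorem baskakovWeight_nonneg {p q x : ℝ} (hq : 0 < q) (hqp : q < p) (hx : 0 ≤ x) (n k : ℕ) :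
    0 ≤ baskakovWeight p q (n + 1) x k := by
  rw [baskakovWeight_succ]
  exact mul_nonneg (trialWeight_nonneg hq hqp hx n k)
    (div_nonneg (pow_pos (hq.trans hqp) _).le (pqFactor_pos hq hqp hx _).le)

theorem trialWeight_le {p q x : ℝ} (hq : 0 < q) (hqp : q < p) (hx : 0 ≤ x) (n k : ℕ) :
    trialWeight p q x n k ≤ (1 + x) * baskakovWeight p q (n + 1) x k := by
  have hT := trialWeight_nonneg hq hqp hx n k
  have hD := pqFactor_pos hq hqp hx (n + k)
  have hle : q ^ (n + k) ≤ p ^ (n + k) := pow_le_pow_left₀ hq.le hqp.le _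
  have h : 1 ≤ (1 + x) * (p ^ (n + k) / (p ^ (n + k) + q ^ (n + k) * x)) := by
    rw [← mul_div_assoc, one_le_div hD]
    nlinarith [mul_le_mul_of_nonneg_right hle hx]
  rw [baskakovWeight_succ]
  nlinarith [mul_le_mul_of_nonneg_left h hT]

theorem baskakovWeight_eq_sub {p q x : ℝ} (hq : 0 < q) (hqp : q < p) (hx : 0 ≤ x) (n k : ℕ) :
    baskakovWeight p q (n + 1) x k = trialWeight p q x n k -
      trialWeight p q x n k * (q ^ (n + k) * x / (p ^ (n + k) + q ^ (n + k) * x)) := by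
  have := (pqFactor_pos hq hqp hx (n + k)).ne'
  rw [baskakovWeight_succ]
  field_simp
  ring

/-- Telescoping: if `v k = P k - P (k + 1) + u (k + 1)` with nonnegative terms and `P = O(v)`, then
`v` has the same sum as `u`. -/
theorem hasSum_of_telescope {u v P : ℕ → ℝ} {s c : ℝ} (hu : HasSum u s) (hu0 : ∀ k, 0 ≤ u k)
    (hv0 : ∀ k, 0 ≤ v k) (hP0 : ∀ k, 0 ≤ P k) (h0 : P 0 = u 0)
    (h : ∀ k, v k = P k - P (k + 1) + u (k + 1)) (hle : ∀ k, P k ≤ c * v k) : HasSum v s := by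
  have hsum : ∀ K, ∑ k ∈ Finset.range K, v k = ∑ k ∈ Finset.range (K + 1), u k - P K := by
    intro K
    induction K with
    | zero => simp [h0]
    | succ K ih => rw [Finset.sum_range_succ, ih, Finset.sum_range_succ _ (K + 1), h]; ring
  have hv : Summable v := summable_of_sum_range_le (c := s) hv0 fun K => by
    rw [hsum]
    linarith [hP0 K, sum_le_hasSum (Finset.range (K + 1)) (fun k _ => hu0 k) hu]
  have hP : Tendsto P atTop (nhds 0) := by
    refine squeeze_zero hP0 hle ?_
    simpa using hv.tendsto_atTop_zero.const_mul c
  refine (hasSum_iff_tendsto_nat_of_nonneg hv0 s).2 ?_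
  simp only [hsum]
  simpa using ((tendsto_add_atTop_iff_nat 1).2 hu.tendsto_sum_nat).sub hP

theorem hasSum_baskakovWeight {p q x : ℝ} (hq : 0 < q) (hqp : q < p) (hx : 0 ≤ x) (n : ℕ) :
    HasSum (baskakovWeight p q (n + 1) x) 1 := by
  induction n with
  | zero =>
    refine hasSum_of_telescope (P := trialWeight p q x 0) (hasSum_pi_single 0 (1 : ℝ))
      (fun k => ?_) (baskakovWeight_nonneg hq hqp hx 0) (trialWeight_nonneg hq hqp hx 0) ?_
      (fun k => ?_) (trialWeight_le hq hqp hx 0)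
    · exact (Pi.single_nonneg.2 zero_le_one : (0 : ℕ → ℝ) ≤ Pi.single 0 1) k
    · simp [trialWeight, pqFact, pqOnePlusPow]
    · rw [baskakovWeight_eq_sub hq hqp hx, trialWeight_zero_succ hq hqp hx]
      simp
  | succ n ih =>
    refine hasSum_of_telescope ih (baskakovWeight_nonneg hq hqp hx n)
      (baskakovWeight_nonneg hq hqp hx (n + 1)) (trialWeight_nonneg hq hqp hx (n + 1))
      (trialWeight_succ_zero hq hqp n) (fun k => ?_) (trialWeight_le hq hqp hx (n + 1))
    rw [baskakovWeight_eq_sub hq hqp hx, trialWeight_succ_succ hq hqp hx]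
    ring

theorem baskakovNode_zero (p q : ℝ) (n : ℕ) : baskakovNode p q n 0 = 0 := by
  simp [baskakovNode, pqInt_zero]

theorem baskakovWeight_mul_node {p q x : ℝ} (hq : 0 < q) (hqp : q < p) (hx : 0 ≤ x) (n k : ℕ) :
    baskakovWeight p q (n + 1) x (k + 1) * baskakovNode p q (n + 1) (k + 1) =
      x * baskakovWeight p q (n + 2) x k := by
  have := (pqFact_pos hq hqp k).ne'
  have := (pqFact_pos hq hqp n).ne'
  have := (pqInt_pos hq hqp n.succ_ne_zero).ne'
  have := (pqInt_pos hq hqp k.succ_ne_zero).ne'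
  have := (pqOnePlusPow_pos hq hqp hx (n + k + 2)).ne'
  rw [baskakovWeight, baskakovWeight, baskakovNode, pqChoose, pqChoose,
    show n + 1 + (k + 1) - 1 = n + k + 1 by lia, show n + 2 + k - 1 = n + k + 1 by lia,
    show n + 1 + (k + 1) = n + k + 2 by lia, show n + 2 + k = n + k + 2 by lia,
    show n + k + 1 - (k + 1) = n by lia, show n + k + 1 - k = n + 1 by lia,
    Nat.triangle_succ k, Nat.triangle_succ (n + 1)]
  simp only [Nat.add_sub_cancel]
  rw [pqFact.eq_2 p q n, pqFact.eq_2 p q k]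
  field_simp
  ring

theorem baskakovNode_succ {p q : ℝ} (hq : 0 < q) (hqp : q < p) (n k : ℕ) :
    baskakovNode p q (n + 1) (k + 1) = p ^ n / pqInt p q (n + 1) +
      (1 + p ^ (n + 1) / (q * pqInt p q (n + 1))) * baskakovNode p q (n + 2) k := by
  have := (pqInt_pos hq hqp n.succ_ne_zero).ne'
  have h2 := (pqInt_pos hq hqp (n + 1).succ_ne_zero).ne'
  have hrec : pqInt p q (n + 1 + 1) = q * pqInt p q (n + 1) + p ^ (n + 1) := by
    rw [pqInt_add hqp (n + 1) 1, pqInt_one hqp]; ring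
  have hc : 1 + p ^ (n + 1) / (q * pqInt p q (n + 1)) =
      pqInt p q (n + 2) / (q * pqInt p q (n + 1)) := by
    rw [hrec]
    field_simp
  rw [hc]
  cases k with
  | zero => simp [baskakovNode, pqInt_zero, pqInt_one hqp]
  | succ k =>
    have hk : pqInt p q (k + 1 + 1) = q ^ (k + 1) + p * pqInt p q (k + 1) := by
      rw [add_comm (k + 1) 1, pqInt_add hqp 1 (k + 1), pqInt_one hqp]; ring
    simp only [baskakovNode, Nat.add_sub_cancel, hk, show n + 2 - 1 = n + 1 by lia]
    field_simp
    ring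

theorem hasSum_baskakovWeight_mul_node {p q x : ℝ} (hq : 0 < q) (hqp : q < p) (hx : 0 ≤ x)
    (n : ℕ) :
    HasSum (fun k => baskakovWeight p q (n + 1) x k * baskakovNode p q (n + 1) k) x := by
  rw [← hasSum_nat_add_iff' 1]
  simp only [baskakovWeight_mul_node hq hqp hx, Finset.sum_range_one, baskakovNode_zero]
  simpa using (hasSum_baskakovWeight hq hqp hx (n + 1)).mul_left x

theorem hasSum_baskakovWeight_mul_node_sq {p q x : ℝ} (hq : 0 < q) (hqp : q < p) (hx : 0 ≤ x)
    (n : ℕ) :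
    HasSum (fun k => baskakovWeight p q (n + 1) x k * baskakovNode p q (n + 1) k ^ 2)
      (p ^ n / pqInt p q (n + 1) * x + (1 + p ^ (n + 1) / (q * pqInt p q (n + 1))) * x ^ 2) := by
  rw [← hasSum_nat_add_iff' 1]
  simp only [sq (baskakovNode _ _ _ _), ← mul_assoc, baskakovWeight_mul_node hq hqp hx,
    Finset.sum_range_one, baskakovNode_zero]
  convert ((hasSum_baskakovWeight hq hqp hx (n + 1)).mul_left
      (p ^ n / pqInt p q (n + 1) * x)).add
    ((hasSum_baskakovWeight_mul_node hq hqp hx (n + 1)).mul_left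
      ((1 + p ^ (n + 1) / (q * pqInt p q (n + 1))) * x)) using 1
  · rfl
  · funext k
    rw [baskakovNode_succ hq hqp]
    ring
  · ring

theorem rn_nonneg {p q : ℝ} (hq : 0 < q) (hqp : q < p) (n : ℕ) (x : ℝ) :
    0 ≤ rn p q (n + 1) x := by
  have hp := hq.trans hqp
  have := pqInt_pos hq hqp n.succ_ne_zero
  refine div_nonneg ?_ (by positivity)
  have : p ^ n ≤ √(p ^ (2 * (n + 1) - 2) +
      4 * pqInt p q (n + 1) * (pqInt p q (n + 1) + p ^ (n + 1) / q) * x ^ 2) := by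
    apply Real.le_sqrt_of_sq_le
    rw [show 2 * (n + 1) - 2 = n * 2 by lia, pow_mul]
    exact le_add_of_nonneg_right (by positivity)
  rw [Nat.add_sub_cancel]
  linarith

theorem rn_quadratic {p q : ℝ} (hq : 0 < q) (hqp : q < p) (n : ℕ) (x : ℝ) :
    p ^ n / pqInt p q (n + 1) * rn p q (n + 1) x +
      (1 + p ^ (n + 1) / (q * pqInt p q (n + 1))) * rn p q (n + 1) x ^ 2 = x ^ 2 := by
  have hp := hq.trans hqp
  have hN := pqInt_pos hq hqp n.succ_ne_zero
  have hA : 0 < pqInt p q (n + 1) + p ^ (n + 1) / q := by positivity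
  have hs := Real.sq_sqrt (show 0 ≤ (p ^ n) ^ 2 +
    4 * pqInt p q (n + 1) * (pqInt p q (n + 1) + p ^ (n + 1) / q) * x ^ 2 by positivity)
  have hA' : 1 + p ^ (n + 1) / (q * pqInt p q (n + 1)) =
      (pqInt p q (n + 1) + p ^ (n + 1) / q) / pqInt p q (n + 1) := by
    field_simp
  rw [hA', rn, Nat.add_sub_cancel, show 2 * (n + 1) - 2 = n * 2 by lia, pow_mul]
  generalize pqInt p q (n + 1) + p ^ (n + 1) / q = A at *
  generalize √((p ^ n) ^ 2 + 4 * pqInt p q (n + 1) * A * x ^ 2) = s at *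
  field_simp
  linear_combination hs

theorem kingBaskakov_central_moments (p q : ℝ) (n : ℕ) (x : ℝ)
    (hq : 0 < q) (hqp : q < p) (hp : p ≤ 1) (hn : 1 ≤ n) (hx : 0 ≤ x) :
    kingBaskakov p q n (fun t => t - x) x = rn p q n x - x ∧
      kingBaskakov p q n (fun t => (t - x) ^ 2) x = 2 * x ^ 2 - 2 * x * rn p q n x := by
  obtain ⟨m, rfl⟩ := Nat.exists_eq_add_of_le' hn
  have hr := rn_nonneg hq hqp m x
  have h0 := hasSum_baskakovWeight hq hqp hr m
  have h1 := hasSum_baskakovWeight_mul_node hq hqp hr m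
  have h2 := hasSum_baskakovWeight_mul_node_sq hq hqp hr m
  rw [rn_quadratic hq hqp] at h2
  constructor
  · refine HasSum.tsum_eq ?_
    change HasSum (fun k => baskakovWeight p q (m + 1) (rn p q (m + 1) x) k *
      (baskakovNode p q (m + 1) k - x)) _
    convert h1.sub (h0.mul_left x) using 1
    · rfl
    · funext k
      ring
    · ring
  · refine HasSum.tsum_eq ?_
    change HasSum (fun k => baskakovWeight p q (m + 1) (rn p q (m + 1) x) k *
      (baskakovNode p q (m + 1) k - x) ^ 2) _
    convert (h2.sub (h1.mul_left (2 * x))).add (h0.mul_left (x ^ 2)) using 1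
    · rfl
    · funext k
      ring
    · ring
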